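/- arXiv:2211.06551 — 2 statements merged into one kernel-verified Lean document; each statement's English description precedes it below -/
import Mathlib

section
/- For every τ > 0 and every R > 0, 0 ≤ 1 − ∫_0^{2R} p_τ(z) (2 − z/R) dz ≤ (2/R) · √(τ/(2π)). In particular, the quantity 1 − ∫_0^{2R} p_τ(z)(2 − z/R) dz equals 2 ∫_{2R}^{∞} p_τ(z) dz + (1/R) ∫_0^{2R} z·p_τ(z) dz, and both terms are nonnegative. -/
open MeasureTheory

/-- The one-dimensional heat kernel `p_t(x) = (2πt)^{-1/2} exp(-x²/(2t))`. -/
noncomputable def heatKernel (t x : ℝ) : ℝ :=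
  (Real.sqrt (2 * Real.pi * t))⁻¹ * Real.exp (-x ^ 2 / (2 * t))

lemma hk_eq (τ z : ℝ) : heatKernel τ z =
    (Real.sqrt (2 * Real.pi * τ))⁻¹ * Real.exp (-(1 / (2 * τ)) * z ^ 2) := by
  unfold heatKernel
  congr 2
  ring

lemma hk_nonneg (τ z : ℝ) : 0 ≤ heatKernel τ z := by
  unfold heatKernel
  positivity

lemma hk_integrable (τ : ℝ) (hτ : 0 < τ) : Integrable (heatKernel τ) := by
  have h := (integrable_exp_neg_mul_sq (b := 1 / (2 * τ)) (by positivity)).const_mul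
    (Real.sqrt (2 * Real.pi * τ))⁻¹
  exact h.congr (Filter.Eventually.of_forall fun z => (hk_eq τ z).symm)

lemma id_hk_integrable (τ : ℝ) (hτ : 0 < τ) : Integrable (fun z => z * heatKernel τ z) := by
  have h := (integrable_mul_exp_neg_mul_sq (b := 1 / (2 * τ)) (by positivity)).const_mul
    (Real.sqrt (2 * Real.pi * τ))⁻¹
  refine h.congr (Filter.Eventually.of_forall fun z => ?_)
  simp only [hk_eq]
  ring

lemma hk_half (τ : ℝ) (hτ : 0 < τ) : ∫ z in Set.Ioi (0:ℝ), heatKernel τ z = 1 / 2 := by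
  simp only [hk_eq]
  rw [integral_const_mul, integral_gaussian_Ioi]
  have e : Real.pi / (1 / (2 * τ)) = 2 * Real.pi * τ := by field_simp
  rw [e]
  have : Real.sqrt (2 * Real.pi * τ) ≠ 0 := by positivity
  field_simp

lemma hk_deriv (τ : ℝ) (hτ : 0 < τ) (z : ℝ) :
    HasDerivAt (fun z => -τ * heatKernel τ z) (z * heatKernel τ z) z := by
  unfold heatKernel
  have h1 : HasDerivAt (fun z : ℝ => -z ^ 2 / (2 * τ)) (-(2 * z) / (2 * τ)) z := by
    simpa using ((hasDerivAt_pow 2 z).neg).div_const (2 * τ)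
  have h2 := ((h1.exp).const_mul (Real.sqrt (2 * Real.pi * τ))⁻¹).const_mul (-τ)
  refine h2.congr_deriv ?_
  field_simp

lemma hk_tendsto (τ : ℝ) (hτ : 0 < τ) :
    Filter.Tendsto (fun z => -τ * heatKernel τ z) Filter.atTop (nhds 0) := by
  unfold heatKernel
  have h1 : Filter.Tendsto (fun z : ℝ => -z ^ 2 / (2 * τ)) Filter.atTop Filter.atBot := by
    refine Filter.Tendsto.atBot_div_const (by positivity) ?_
    exact Filter.tendsto_neg_atTop_atBot.comp (Filter.tendsto_pow_atTop (by norm_num))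
  have h2 := ((Real.tendsto_exp_atBot.comp h1).const_mul
    (Real.sqrt (2 * Real.pi * τ))⁻¹).const_mul (-τ)
  simpa using h2

lemma id_hk_integral (τ : ℝ) (hτ : 0 < τ) :
    ∫ z in Set.Ioi (0:ℝ), z * heatKernel τ z = Real.sqrt (τ / (2 * Real.pi)) := by
  rw [integral_Ioi_of_hasDerivAt_of_tendsto' (fun z _ => hk_deriv τ hτ z)
    (id_hk_integrable τ hτ).integrableOn (hk_tendsto τ hτ)]
  have e : heatKernel τ 0 = (Real.sqrt (2 * Real.pi * τ))⁻¹ := by simp [heatKernel]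
  rw [e, Real.sqrt_mul (by positivity), Real.sqrt_div hτ.le]
  have h3 := Real.mul_self_sqrt hτ.le
  have : Real.sqrt τ ≠ 0 := by positivity
  have : Real.sqrt (2 * Real.pi) ≠ 0 := by positivity
  field_simp
  nlinarith



/-- For `τ > 0` and `R > 0`, `0 ≤ 1 - ∫_0^{2R} p_τ(z)(2 - z/R) dz ≤ (2/R)·√(τ/(2π))`;
moreover this quantity equals `2∫_{2R}^∞ p_τ(z) dz + (1/R)∫_0^{2R} z p_τ(z) dz`,
and both of these terms are nonnegative. -/
theorem one_sub_integral_heatKernel_bound (τ R : ℝ) (hτ : 0 < τ) (hR : 0 < R) :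
    0 ≤ 1 - (∫ z in (0:ℝ)..(2 * R), heatKernel τ z * (2 - z / R)) ∧
    1 - (∫ z in (0:ℝ)..(2 * R), heatKernel τ z * (2 - z / R))
      ≤ 2 / R * Real.sqrt (τ / (2 * Real.pi)) ∧
    1 - (∫ z in (0:ℝ)..(2 * R), heatKernel τ z * (2 - z / R))
      = 2 * (∫ z in Set.Ioi (2 * R), heatKernel τ z)
        + (1 / R) * ∫ z in (0:ℝ)..(2 * R), z * heatKernel τ z ∧
    0 ≤ ∫ z in Set.Ioi (2 * R), heatKernel τ z ∧
    0 ≤ ∫ z in (0:ℝ)..(2 * R), z * heatKernel τ z := by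
  have hi := hk_integrable τ hτ
  have hj := id_hk_integrable τ hτ
  have A := intervalIntegral.integral_interval_add_Ioi (a := 0) (b := 2 * R)
    hi.integrableOn hi.integrableOn
  have B := intervalIntegral.integral_interval_add_Ioi (a := 0) (b := 2 * R)
    hj.integrableOn hj.integrableOn
  rw [hk_half τ hτ] at A
  rw [id_hk_integral τ hτ] at B
  have C : (∫ z in (0:ℝ)..(2 * R), heatKernel τ z * (2 - z / R))
      = 2 * (∫ z in (0:ℝ)..(2 * R), heatKernel τ z)
        - (1 / R) * ∫ z in (0:ℝ)..(2 * R), z * heatKernel τ z := by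
    rw [← intervalIntegral.integral_const_mul, ← intervalIntegral.integral_const_mul,
      ← intervalIntegral.integral_sub (hi.intervalIntegrable.const_mul 2)
        (hj.intervalIntegrable.const_mul (1 / R))]
    congr 1
    funext z
    ring
  have N1 : 0 ≤ ∫ z in Set.Ioi (2 * R), heatKernel τ z :=
    integral_nonneg fun z => hk_nonneg τ z
  have N2 : 0 ≤ ∫ z in (0:ℝ)..(2 * R), z * heatKernel τ z :=
    intervalIntegral.integral_nonneg (by positivity)
      fun z hz => mul_nonneg hz.1 (hk_nonneg τ z)
  have D : 2 * R * (∫ z in Set.Ioi (2 * R), heatKernel τ z)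
      ≤ ∫ z in Set.Ioi (2 * R), z * heatKernel τ z := by
    rw [← integral_const_mul]
    refine setIntegral_mono_on (hi.integrableOn.const_mul _) hj.integrableOn
      measurableSet_Ioi fun z hz => ?_
    exact mul_le_mul_of_nonneg_right (le_of_lt hz) (hk_nonneg τ z)
  have E : 1 - (∫ z in (0:ℝ)..(2 * R), heatKernel τ z * (2 - z / R))
      = 2 * (∫ z in Set.Ioi (2 * R), heatKernel τ z)
        + (1 / R) * ∫ z in (0:ℝ)..(2 * R), z * heatKernel τ z := by
    rw [C]
    linarith
  refine ⟨?_, ?_, E, N1, N2⟩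
  · rw [E]
    positivity
  · rw [E]
    have hs := Real.sqrt_nonneg (τ / (2 * Real.pi))
    have e : 2 * (∫ z in Set.Ioi (2 * R), heatKernel τ z)
        + (1 / R) * (∫ z in (0:ℝ)..(2 * R), z * heatKernel τ z)
        = (2 * R * (∫ z in Set.Ioi (2 * R), heatKernel τ z)
        + ∫ z in (0:ℝ)..(2 * R), z * heatKernel τ z) / R := by
      field_simp
    rw [e, div_mul_eq_mul_div]
    gcongr
    linarith
end

section
/- For every t > 0 there is a constant c > 0, depending only on t, such that for all R ≥ 1, ∫_0^{t} |1 − ∫_0^{2R} p_{2(t−r)}(z) (2 − z/R) dz| dr ≤ c/R. -/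
open MeasureTheory

lemma integral_id_mul_exp_neg_sq (b : ℝ) (hb : 0 < b) :
    ∫ z in Set.Ioi (0:ℝ), z * Real.exp (-b * z ^ 2) = (2 * b)⁻¹ := by
  have h := integral_mul_cexp_neg_mul_sq (b := (b : ℂ)) (by simpa using hb)
  have h2 : ∫ z in Set.Ioi (0:ℝ), ((z * Real.exp (-b * z ^ 2) : ℝ) : ℂ) = (2 * (b:ℂ))⁻¹ := by
    rw [← h]
    congr 1
    ext z
    push_cast
    rfl
  rw [integral_complex_ofReal] at h2
  exact_mod_cast h2

lemma heat_pointwise (s R : ℝ) (hs : 0 < s) (hR : 1 ≤ R) :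
    |1 - ∫ z in (0:ℝ)..(2 * R), heatKernel s z * (2 - z / R)|
      ≤ (Real.sqrt (2 * Real.pi * s))⁻¹ * s / R := by
  have hR0 : 0 < R := by linarith
  set b : ℝ := 1 / (2 * s) with hb
  have hb0 : 0 < b := by positivity
  set K : ℝ := (Real.sqrt (2 * Real.pi * s))⁻¹ with hK
  have hsq : 0 < Real.sqrt (2 * Real.pi * s) := Real.sqrt_pos.2 (by positivity)
  have hk : ∀ z, heatKernel s z = K * Real.exp (-b * z ^ 2) := by
    intro z
    unfold heatKernel
    rw [hK, hb]
    congr 2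
    field_simp
  have i0 : IntegrableOn (fun z : ℝ => Real.exp (-b * z ^ 2)) (Set.Ioi 0) :=
    (integrable_exp_neg_mul_sq hb0).integrableOn
  have i1 : IntegrableOn (fun z : ℝ => z * Real.exp (-b * z ^ 2)) (Set.Ioi 0) :=
    (integrable_mul_exp_neg_mul_sq hb0).integrableOn
  have e0 : ∫ z in Set.Ioi (0:ℝ), 2 * K * Real.exp (-b * z ^ 2) = 1 := by
    rw [integral_const_mul, integral_gaussian_Ioi]
    have : Real.pi / b = 2 * Real.pi * s := by rw [hb]; field_simp
    rw [this, hK]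
    field_simp
  have e1 : ∫ z in Set.Ioi (0:ℝ), K / R * (z * Real.exp (-b * z ^ 2)) = K * s / R := by
    rw [integral_const_mul, integral_id_mul_exp_neg_sq b hb0, hb]
    field_simp
  have j0 := i0.const_mul (2 * K)
  have j1 := i1.const_mul (K / R)
  have hg : ∀ z, heatKernel s z * (2 - z / R) =
      2 * K * Real.exp (-b * z ^ 2) - K / R * (z * Real.exp (-b * z ^ 2)) := by
    intro z; rw [hk]; ring
  have jg : IntegrableOn (fun z => heatKernel s z * (2 - z / R)) (Set.Ioi 0) := by
    simp_rw [hg]; exact j0.sub j1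
  have eg : ∫ z in Set.Ioi (0:ℝ), heatKernel s z * (2 - z / R) = 1 - K * s / R := by
    simp_rw [hg]
    rw [integral_sub j0 j1, e0, e1]
  have hpos : ∀ z, 0 ≤ heatKernel s z := fun z => by unfold heatKernel; positivity
  rw [intervalIntegral.integral_of_le (by positivity)]
  have hsub : Set.Ioc (0:ℝ) (2 * R) ⊆ Set.Ioi 0 := Set.Ioc_subset_Ioi_self
  have up : ∫ z in Set.Ioc (0:ℝ) (2 * R), heatKernel s z * (2 - z / R) ≤ 1 := by
    rw [← e0]
    refine (setIntegral_mono_on (jg.mono_set hsub) (IntegrableOn.mono_set j0 hsub) measurableSet_Ioc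
      (fun z hz => ?_)).trans
      (setIntegral_mono_set j0 (Filter.Eventually.of_forall fun z => ?_) hsub.eventuallyLE)
    · have : 0 ≤ K * Real.exp (-b * z ^ 2) * (z / R) := by
        have := hz.1
        positivity
      rw [hk]; nlinarith
    · simp only [Pi.zero_apply]; positivity
  have lo : 1 - K * s / R ≤ ∫ z in Set.Ioc (0:ℝ) (2 * R), heatKernel s z * (2 - z / R) := by
    rw [← eg, ← Set.Ioc_union_Ioi_eq_Ioi (show (0:ℝ) ≤ 2 * R by positivity),
      setIntegral_union (Set.Ioc_disjoint_Ioi le_rfl) measurableSet_Ioi (jg.mono_set hsub)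
        (jg.mono_set (Set.Ioi_subset_Ioi (by positivity)))]
    have : ∫ z in Set.Ioi (2 * R), heatKernel s z * (2 - z / R) ≤ 0 := by
      refine setIntegral_nonpos measurableSet_Ioi fun z hz => ?_
      refine mul_nonpos_of_nonneg_of_nonpos (hpos z) ?_
      have : 2 ≤ z / R := by rw [le_div_iff₀ hR0]; exact le_of_lt hz
      linarith
    linarith
  rw [abs_of_nonneg (by linarith)]
  linarith

/-- For every `t > 0` there is a constant `c > 0` depending only on `t` such that for
all `R ≥ 1`, `∫_0^t |1 - ∫_0^{2R} p_{2(t-r)}(z)(2 - z/R) dz| dr ≤ c/R`. -/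
theorem integrated_rate_estimate (t : ℝ) (ht : 0 < t) :
    ∃ c : ℝ, 0 < c ∧ ∀ R : ℝ, 1 ≤ R →
      (∫ r in (0:ℝ)..t,
        |1 - ∫ z in (0:ℝ)..(2 * R), heatKernel (2 * (t - r)) z * (2 - z / R)|)
        ≤ c / R := by
  refine ⟨Real.sqrt (2 * t) * t, by positivity, fun R hR => ?_⟩
  have hR0 : 0 < R := by linarith
  have key := intervalIntegral.norm_integral_le_of_norm_le_const_ae (a := 0) (b := t)
    (C := Real.sqrt (2 * t) / R)
    (f := fun r => |1 - ∫ z in (0:ℝ)..(2 * R), heatKernel (2 * (t - r)) z * (2 - z / R)|) ?_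
  · refine (le_abs_self _).trans (key.trans (le_of_eq ?_))
    rw [sub_zero, abs_of_pos ht]; ring
  · filter_upwards [Measure.ae_ne volume t] with r hrt hr
    rw [Set.uIoc_of_le ht.le] at hr
    have hlt : r < t := lt_of_le_of_ne hr.2 hrt
    rw [Real.norm_eq_abs, abs_abs]
    have hs : 0 < 2 * (t - r) := by linarith
    refine (heat_pointwise _ R hs hR).trans ?_
    have hsq : 0 < Real.sqrt (2 * Real.pi * (2 * (t - r))) := Real.sqrt_pos.2 (by positivity)
    gcongr
    rw [inv_mul_le_iff₀ hsq, ← Real.sqrt_mul (by positivity)]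
    apply Real.le_sqrt_of_sq_le
    have h1 : 2 * (t - r) ≤ 2 * t := by linarith [hr.1]
    have h2 : (1:ℝ) ≤ 2 * Real.pi := by linarith [Real.pi_gt_three]
    have h3 := mul_le_mul h2 h1 hs.le (by positivity)
    nlinarith [mul_le_mul_of_nonneg_left h3 hs.le]
end
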